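/- Let A be a commutative ring with a ℤ-grading A = ⊕_{d∈ℤ} A_d, let r ≥ 1, and suppose A is generated as a ring by A₀ together with a set S of homogeneous elements whose degrees all lie in the interval [−r, r]. Let I be the ideal generated by all homogeneous elements of nonzero degree, and for m ≥ 0 let J_m be the ideal generated by all homogeneous elements of degree d with |d| > m. Then for every n ≥ 1, the ideal generated by all homogeneous elements of degree d with |d| ≥ nr is contained in I^n; in particular J_{nr} ⊆ I^n. Combined with the inclusion I^{2n+1} ⊆ J_n, this shows the filtrations {I^n}_{n≥1} and {J_m}_{m≥0} are mutually cofinal: for each n there is m with I^m ⊆ J_n and J_m ⊆ I^n. (This is the equivalence of the systems of ideals {(𝒲_{<−n}, 𝒲_{>n})}_n and {(𝒲_{≠0})^n}_n in the paper's proof of the completion Lemma for weighted dagger dg algebras.) -/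

import Mathlib

/-- The hypothesis `n * r < |d| + r` says that `n` is at most the ceiling of `|d| / r`. -/
theorem decompose_mem_pow_of_closure_eq_top {A : Type*} [CommRing A] (𝒜 : ℤ → AddSubgroup A)
    [GradedRing 𝒜] (r : ℕ) (hr : 1 ≤ r) (S : Set A)
    (hSdeg : ∀ x ∈ S, ∃ d : ℤ, |d| ≤ (r : ℤ) ∧ x ∈ 𝒜 d)
    (hgen : Subring.closure ((𝒜 (0 : ℤ) : Set A) ∪ S) = ⊤)
    (a : A) (d : ℤ) (n : ℕ) (hn : (n : ℤ) * r < |d| + r) :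
    (DirectSum.decompose 𝒜 a d : A) ∈
      Ideal.span {x : A | ∃ d : ℤ, d ≠ 0 ∧ x ∈ 𝒜 d} ^ n := by
  classical
  set I := Ideal.span {x : A | ∃ d : ℤ, d ≠ 0 ∧ x ∈ 𝒜 d}
  have hr' : (1 : ℤ) ≤ r := by exact_mod_cast hr
  have hom : ∀ (x : A) (e : ℤ), x ∈ 𝒜 e →
      (∀ n : ℕ, (n : ℤ) * r < |e| + r → x ∈ I ^ n) →
      ∀ (d : ℤ) (n : ℕ), (n : ℤ) * r < |d| + r → (DirectSum.decompose 𝒜 x d : A) ∈ I ^ n := by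
    intro x e hx h d n hn
    by_cases hde : e = d
    · subst hde
      rw [DirectSum.decompose_of_mem_same 𝒜 hx]
      exact h n hn
    · rw [DirectSum.decompose_of_mem_ne 𝒜 hx hde]
      exact zero_mem _
  have ha : a ∈ Subring.closure ((𝒜 (0 : ℤ) : Set A) ∪ S) := hgen ▸ Subring.mem_top a
  have deg_zero : ∀ x ∈ 𝒜 0, ∀ (d : ℤ) (n : ℕ), (n : ℤ) * r < |d| + r →
      (DirectSum.decompose 𝒜 x d : A) ∈ I ^ n := by
    intro x hx
    refine hom x 0 hx fun n hn => ?_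
    obtain rfl : n = 0 := by
      by_contra h
      have : (1 : ℤ) ≤ n := by omega
      rw [abs_zero] at hn
      nlinarith
    simp
  induction ha using Subring.closure_induction generalizing d n with
  | mem x hx =>
    rcases hx with hx | hx
    · exact deg_zero x hx d n hn
    · obtain ⟨e, he, hxe⟩ := hSdeg x hx
      refine hom x e hxe (fun n hn => ?_) d n hn
      have hn1 : n < 2 := by
        by_contra h
        have : (2 : ℤ) ≤ n := by omega
        nlinarith
      interval_cases n
      · simp
      · rw [pow_one]
        refine Ideal.subset_span ⟨e, ?_, hxe⟩
        rintro rfl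
        simp at hn
  | zero => simp
  | one => exact deg_zero 1 SetLike.GradedOne.one_mem d n hn
  | add x y _ _ hx hy =>
    rw [DirectSum.decompose_add, DirectSum.add_apply, AddSubgroup.coe_add]
    exact add_mem (hx d n hn) (hy d n hn)
  | neg x _ hx =>
    rw [DirectSum.decompose_neg, DFinsupp.neg_apply, AddSubgroup.coe_neg]
    exact neg_mem (hx d n hn)
  | mul x y _ _ hx hy =>
    have ceil : ∀ i : ℤ, ∃ p : ℕ, |i| ≤ (p : ℤ) * r ∧ (p : ℤ) * r < |i| + r := by
      intro i
      refine ⟨(i.natAbs + (r - 1)) / r, ?_⟩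
      have h1 := Nat.div_add_mod (i.natAbs + (r - 1)) r
      have h2 := Nat.mod_lt (i.natAbs + (r - 1)) hr
      rw [mul_comm] at h1
      rw [Int.abs_eq_natAbs]
      generalize (i.natAbs + (r - 1)) / r = p at *
      norm_cast
      omega
    rw [← DirectSum.sum_support_decompose 𝒜 x, ← DirectSum.sum_support_decompose 𝒜 y,
      Finset.sum_mul_sum, DirectSum.decompose_sum, DFinsupp.finsetSum_apply,
      AddSubgroup.val_finsetSum]
    refine sum_mem fun i _ => ?_
    rw [DirectSum.decompose_sum, DFinsupp.finsetSum_apply, AddSubgroup.val_finsetSum]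
    refine sum_mem fun j _ => ?_
    refine hom _ (i + j) (SetLike.GradedMul.mul_mem (SetLike.coe_mem _) (SetLike.coe_mem _))
      (fun n hn => ?_) d n hn
    obtain ⟨p, hp, hp'⟩ := ceil i
    obtain ⟨q, hq, hq'⟩ := ceil j
    have hnpq : n ≤ p + q := by
      by_contra h
      have : (p : ℤ) + q + 1 ≤ n := by omega
      have := abs_add_le i j
      nlinarith
    refine Ideal.pow_le_pow_right hnpq ?_
    rw [pow_add]
    exact Ideal.mul_mem_mul (hx i p hp') (hy j q hq')

theorem span_homogeneous_le_pow {A : Type*} [CommRing A] (𝒜 : ℤ → AddSubgroup A)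
    [GradedRing 𝒜] (r : ℕ) (hr : 1 ≤ r) (S : Set A)
    (hSdeg : ∀ x ∈ S, ∃ d : ℤ, |d| ≤ (r : ℤ) ∧ x ∈ 𝒜 d)
    (hgen : Subring.closure ((𝒜 (0 : ℤ) : Set A) ∪ S) = ⊤) (n : ℕ) :
    Ideal.span {x : A | ∃ d : ℤ, ((n * r : ℕ) : ℤ) ≤ |d| ∧ x ∈ 𝒜 d} ≤
      Ideal.span {x : A | ∃ d : ℤ, d ≠ 0 ∧ x ∈ 𝒜 d} ^ n := by
  refine Ideal.span_le.2 ?_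
  rintro x ⟨d, hd, hx⟩
  rw [← DirectSum.decompose_of_mem_same 𝒜 hx]
  refine decompose_mem_pow_of_closure_eq_top 𝒜 r hr S hSdeg hgen x d n ?_
  push_cast at hd
  omega

open scoped Pointwise in
/-- A product of `k` homogeneous elements of nonzero degree splits into its factors of positive
degree and its factors of negative degree. -/
theorem exists_mul_of_mem_pow_homogeneous {A : Type*} [CommRing A] (𝒜 : ℤ → AddSubgroup A)
    [GradedRing 𝒜] (k : ℕ) (x : A) (hx : x ∈ {x : A | ∃ d : ℤ, d ≠ 0 ∧ x ∈ 𝒜 d} ^ k) :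
    ∃ (p q : ℕ) (d e : ℤ) (u v : A), p + q = k ∧ (p : ℤ) ≤ d ∧ e ≤ -(q : ℤ) ∧
      u ∈ 𝒜 d ∧ v ∈ 𝒜 e ∧ x = u * v := by
  induction k generalizing x with
  | zero =>
    rw [pow_zero, Set.mem_one] at hx
    exact ⟨0, 0, 0, 0, 1, 1, rfl, by simp, by simp, SetLike.GradedOne.one_mem,
      SetLike.GradedOne.one_mem, by simp [hx]⟩
  | succ k ih =>
    rw [pow_succ] at hx
    obtain ⟨y, hy, z, ⟨c, hc, hz⟩, rfl⟩ := Set.mem_mul.1 hx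
    obtain ⟨p, q, d, e, u, v, hpq, hd, he, hu, hv, rfl⟩ := ih y hy
    rcases lt_or_gt_of_ne hc with hc | hc
    · exact ⟨p, q + 1, d, e + c, u, v * z, by omega, hd, by push_cast; omega, hu,
        SetLike.GradedMul.mul_mem hv hz, by ring⟩
    · exact ⟨p + 1, q, d + c, e, u * z, v, by omega, by push_cast; omega, he,
        SetLike.GradedMul.mul_mem hu hz, hv, by ring⟩

theorem span_homogeneous_pow_le {A : Type*} [CommRing A] (𝒜 : ℤ → AddSubgroup A)
    [GradedRing 𝒜] (n : ℕ) :
    Ideal.span {x : A | ∃ d : ℤ, d ≠ 0 ∧ x ∈ 𝒜 d} ^ (2 * n + 1) ≤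
      Ideal.span {x : A | ∃ d : ℤ, (n : ℤ) < |d| ∧ x ∈ 𝒜 d} := by
  rw [Ideal.span, Submodule.span_pow, Ideal.span_le]
  intro x hx
  obtain ⟨p, q, d, e, u, v, hpq, hd, he, hu, hv, rfl⟩ :=
    exists_mul_of_mem_pow_homogeneous 𝒜 _ x hx
  rcases Nat.lt_or_ge n p with hp | hp
  · exact Ideal.mul_mem_right _ _ (Ideal.subset_span ⟨d, lt_abs.2 (Or.inl (by omega)), hu⟩)
  · exact Ideal.mul_mem_left _ _ (Ideal.subset_span ⟨e, lt_abs.2 (Or.inr (by omega)), hv⟩)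


/-- Let `A` be a commutative ring with a `ℤ`-grading, generated as a ring by `A₀` together
with a set `S` of homogeneous elements of degrees in `[-r, r]`, for some `r ≥ 1`.  Let `I` be
the ideal generated by all homogeneous elements of nonzero degree and, for `m ≥ 0`, `J_m` the
ideal generated by all homogeneous elements of degree `d` with `|d| > m`.  Then for every
`n ≥ 1` the ideal generated by homogeneous elements with `|d| ≥ n·r` is contained in `I ^ n`;
in particular `J_{n·r} ⊆ I ^ n`.  Combined with `I ^ (2n+1) ⊆ J_n` this makes the two
filtrations `{I ^ n}` and `{J_m}` mutually cofinal. -/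
theorem stmt11 {A : Type*} [CommRing A] (𝒜 : ℤ → AddSubgroup A) [GradedRing 𝒜]
    (r : ℕ) (hr : 1 ≤ r) (S : Set A)
    (hSdeg : ∀ x ∈ S, ∃ d : ℤ, |d| ≤ (r : ℤ) ∧ x ∈ 𝒜 d)
    (hgen : Subring.closure ((𝒜 (0 : ℤ) : Set A) ∪ S) = ⊤) :
    (∀ n : ℕ, 1 ≤ n →
        Ideal.span {x : A | ∃ d : ℤ, ((n * r : ℕ) : ℤ) ≤ |d| ∧ x ∈ 𝒜 d} ≤
          Ideal.span {x : A | ∃ d : ℤ, d ≠ 0 ∧ x ∈ 𝒜 d} ^ n) ∧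
      (∀ n : ℕ, 1 ≤ n →
        Ideal.span {x : A | ∃ d : ℤ, ((n * r : ℕ) : ℤ) < |d| ∧ x ∈ 𝒜 d} ≤
          Ideal.span {x : A | ∃ d : ℤ, d ≠ 0 ∧ x ∈ 𝒜 d} ^ n) ∧
      ∀ n : ℕ, ∃ m : ℕ,
        Ideal.span {x : A | ∃ d : ℤ, d ≠ 0 ∧ x ∈ 𝒜 d} ^ m ≤
            Ideal.span {x : A | ∃ d : ℤ, (n : ℤ) < |d| ∧ x ∈ 𝒜 d} ∧
          Ideal.span {x : A | ∃ d : ℤ, (m : ℤ) < |d| ∧ x ∈ 𝒜 d} ≤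
            Ideal.span {x : A | ∃ d : ℤ, d ≠ 0 ∧ x ∈ 𝒜 d} ^ n := by
  have hJ : ∀ n m : ℕ, n * r ≤ m →
      Ideal.span {x : A | ∃ d : ℤ, (m : ℤ) < |d| ∧ x ∈ 𝒜 d} ≤
        Ideal.span {x : A | ∃ d : ℤ, d ≠ 0 ∧ x ∈ 𝒜 d} ^ n := by
    intro n m hm
    refine le_trans (Ideal.span_mono ?_) (span_homogeneous_le_pow 𝒜 r hr S hSdeg hgen n)
    rintro x ⟨d, hd, hx⟩
    exact ⟨d, le_trans (by exact_mod_cast hm) hd.le, hx⟩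
  exact ⟨fun n _ => span_homogeneous_le_pow 𝒜 r hr S hSdeg hgen n,
    fun n _ => hJ n _ le_rfl,
    fun n => ⟨max (2 * n + 1) (n * r),
      (Ideal.pow_le_pow_right (le_max_left _ _)).trans (span_homogeneous_pow_le 𝒜 n),
      hJ n _ (le_max_right _ _)⟩⟩
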